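/- arXiv:2208.09593 — 2 statements merged into one kernel-verified Lean document; each statement's English description precedes it below -/
import Mathlib

section
/- The integral from 0 to 1 of arctan(x)⁴ dx equals π⁴/256 + (π³/32)·log 2 − (3/8)·π²·G − (9/64)·π·ζ(3) + 3·β(4), where β(s) = ∑_{n≥1} (−1)^{n−1}/(2n−1)^s. -/
open Real

/-- Catalan's constant `G = β(2)`. -/
noncomputable def catalanConst : ℝ := ∑' n : ℕ, (-1 : ℝ) ^ n / (2 * (n : ℝ) + 1) ^ 2

/-- `ζ(3) = ∑_{n≥1} 1/n³`. -/
noncomputable def zeta3 : ℝ := ∑' n : ℕ, 1 / ((n : ℝ) + 1) ^ 3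

/-- Dirichlet beta value `β(4) = ∑_{n≥1} (−1)^{n−1}/(2n−1)⁴`. -/
noncomputable def beta4 : ℝ := ∑' n : ℕ, (-1 : ℝ) ^ n / (2 * (n : ℝ) + 1) ^ 4

open Filter Topology intervalIntegral

/-- The Riemann–Lebesgue lemma on an interval, for continuously differentiable functions. -/
lemma tendsto_integral_mul_sin_of_hasDerivAt {u u' : ℝ → ℝ} {a b : ℝ}
    (hu : ∀ x ∈ Set.uIcc a b, HasDerivAt u (u' x) x) (hu' : ContinuousOn u' (Set.uIcc a b)) :
    Tendsto (fun c : ℝ => ∫ x in a..b, u x * sin (c * x)) atTop (𝓝 0) := by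
  obtain ⟨C, hC⟩ := isCompact_uIcc.exists_bound_of_continuousOn hu'
  have key : ∀ c : ℝ, 0 < c →
      ‖∫ x in a..b, u x * sin (c * x)‖ ≤ (|u b| + |u a| + C * |b - a|) / c := by
    intro c hc
    have hv : ∀ x ∈ Set.uIcc a b, HasDerivAt (fun x => -cos (c * x) / c) (sin (c * x)) x := by
      intro x _
      refine (((hasDerivAt_id x).const_mul c).cos.neg.div_const c).congr_deriv ?_
      simp only [id, mul_one, neg_mul, neg_neg]
      field_simp
    have hcos : ∀ x, |-cos (c * x) / c| ≤ 1 / c := by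
      intro x
      rw [abs_div, abs_neg, abs_of_pos hc]
      gcongr
      exact abs_cos_le_one _
    rw [integral_mul_deriv_eq_deriv_mul hu hv hu'.intervalIntegrable
      (Continuous.intervalIntegrable (by fun_prop) _ _)]
    have hint : ‖∫ x in a..b, u' x * (-cos (c * x) / c)‖ ≤ (C * (1 / c)) * |b - a| := by
      apply norm_integral_le_of_norm_le_const
      intro x hx
      have hx' := hC x (Set.uIoc_subset_uIcc hx)
      rw [norm_mul]
      exact mul_le_mul hx' (hcos x) (norm_nonneg _) ((norm_nonneg _).trans hx')
    have hb : ‖u b * (-cos (c * b) / c)‖ ≤ |u b| * (1 / c) := by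
      rw [norm_mul]
      exact mul_le_mul_of_nonneg_left (hcos b) (abs_nonneg _)
    have ha : ‖u a * (-cos (c * a) / c)‖ ≤ |u a| * (1 / c) := by
      rw [norm_mul]
      exact mul_le_mul_of_nonneg_left (hcos a) (abs_nonneg _)
    refine (norm_sub_le_of_le (norm_sub_le_of_le hb ha) hint).trans (le_of_eq ?_)
    ring
  exact squeeze_zero_norm' ((eventually_gt_atTop 0).mono key)
    (tendsto_const_nhds.div_atTop tendsto_id)

lemma integral_pow_three_mul_sin {a : ℝ} (ha : a ≠ 0) (b : ℝ) :
    ∫ t in (0 : ℝ)..b, t ^ 3 * sin (a * t)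
      = -b ^ 3 * cos (a * b) / a + 3 * b ^ 2 * sin (a * b) / a ^ 2
        + 6 * b * cos (a * b) / a ^ 3 - 6 * sin (a * b) / a ^ 4 := by
  have h : ∀ t ∈ Set.uIcc 0 b, HasDerivAt (fun t : ℝ => -t ^ 3 * cos (a * t) / a
      + 3 * t ^ 2 * sin (a * t) / a ^ 2 + 6 * t * cos (a * t) / a ^ 3
      - 6 * sin (a * t) / a ^ 4) (t ^ 3 * sin (a * t)) t := by
    intro t _
    have hl : HasDerivAt (fun t : ℝ => a * t) a t := by
      simpa using (hasDerivAt_id t).const_mul a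
    have h1 := ((hasDerivAt_pow 3 t).neg.mul hl.cos).div_const a
    have h2 := (((hasDerivAt_pow 2 t).const_mul 3).mul hl.sin).div_const (a ^ 2)
    have h3 := (((hasDerivAt_id t).const_mul 6).mul hl.cos).div_const (a ^ 3)
    have h4 := (hl.sin.const_mul 6).div_const (a ^ 4)
    refine (((h1.add h2).add h3).sub h4).congr_deriv ?_
    simp only [Pi.neg_apply, id]
    field_simp
    push_cast
    ring
  rw [integral_eq_sub_of_hasDerivAt h (Continuous.intervalIntegrable (by fun_prop) _ _)]
  simp

/-- Partial sums of the divergent expansion `tan t = 2 ∑ (-1)^(k-1) sin (2kt)`, with remainder. -/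
lemma sum_sin_eq_tan_sub {t : ℝ} (ht : cos t ≠ 0) (M : ℕ) :
    ∑ m ∈ Finset.range M, (2 * sin ((4 * m + 2) * t) - 2 * sin ((4 * m + 4) * t))
      = tan t - sin ((4 * M + 1) * t) / cos t := by
  induction M with
  | zero => simp [tan_eq_sin_div_cos]
  | succ M ih =>
    rw [Finset.sum_range_succ, ih]
    have e1 : sin ((4 * M + 2) * t) - sin ((4 * M + 4) * t)
        = -2 * sin t * cos ((4 * M + 3) * t) := by
      rw [sin_sub_sin, show ((4 * M + 2) * t - (4 * M + 4) * t) / 2 = -t by ring,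
        show ((4 * M + 2) * t + (4 * M + 4) * t) / 2 = (4 * M + 3) * t by ring, sin_neg]
      ring
    have e2 : sin ((4 * (M + 1 : ℕ) + 1) * t) - sin ((4 * M + 1) * t)
        = 4 * sin t * cos t * cos ((4 * M + 3) * t) := by
      push_cast
      rw [sin_sub_sin, show ((4 * ((M : ℝ) + 1) + 1) * t - (4 * M + 1) * t) / 2 = 2 * t by ring,
        show ((4 * ((M : ℝ) + 1) + 1) * t + (4 * M + 1) * t) / 2 = (4 * M + 3) * t by ring,
        sin_two_mul]
      ring
    rw [← mul_sub, e1, eq_add_of_sub_eq e2]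
    field_simp
    ring

lemma tendsto_alternating_harmonic :
    Tendsto (fun M : ℕ => ∑ m ∈ Finset.range M, (-1 : ℝ) ^ m / ((m : ℝ) + 1))
      atTop (𝓝 (log 2)) := by
  have hanti : Antitone (fun m : ℕ => 1 / ((m : ℝ) + 1)) := by
    intro m n hmn
    dsimp only
    gcongr
  obtain ⟨l, hl⟩ :=
    hanti.tendsto_alternating_series_of_tendsto_zero tendsto_one_div_add_atTop_nhds_zero_nat
  simp only [mul_one_div] at hl
  have htwo : Tendsto (fun n : ℕ => 2 * n) atTop atTop :=
    tendsto_id.const_mul_atTop' (by norm_num)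
  have heven : ∀ K : ℕ, ∑ m ∈ Finset.range (2 * K), (-1 : ℝ) ^ m / ((m : ℝ) + 1)
      = (harmonic (2 * K) : ℝ) - harmonic K := by
    intro K
    induction K with
    | zero => simp
    | succ K ih =>
      rw [show 2 * (K + 1) = 2 * K + 1 + 1 by ring, Finset.sum_range_succ, Finset.sum_range_succ,
        ih, harmonic_succ, harmonic_succ, harmonic_succ, pow_succ, pow_mul]
      push_cast
      field_simp
      ring
  have hlog : Tendsto (fun K : ℕ => (harmonic (2 * K) : ℝ) - harmonic K) atTop (𝓝 (log 2)) := by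
    have h := ((tendsto_harmonic_sub_log.comp htwo).sub tendsto_harmonic_sub_log).add_const (log 2)
    rw [sub_self, zero_add] at h
    refine h.congr' ?_
    filter_upwards [eventually_ne_atTop 0] with K hK
    have hK' : (K : ℝ) ≠ 0 := by exact_mod_cast hK
    simp only [Function.comp_apply, Nat.cast_mul, Nat.cast_ofNat]
    rw [log_mul two_ne_zero hK']
    ring
  have := tendsto_nhds_unique ((hl.comp htwo).congr heven) hlog
  rwa [this] at hl

lemma hasSum_alternating_cubes :
    HasSum (fun m : ℕ => (-1 : ℝ) ^ m / ((m : ℝ) + 1) ^ 3) (3 / 4 * zeta3) := by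
  have hs : Summable (fun m : ℕ => 1 / ((m : ℝ) + 1) ^ 3) := by
    have := (summable_nat_add_iff 1).2 (Real.summable_one_div_nat_pow.2 (by norm_num : 1 < 3))
    simpa using this
  have hz : HasSum (fun m : ℕ => 1 / ((m : ℝ) + 1) ^ 3) zeta3 := hs.hasSum
  have hodd : HasSum (fun m : ℕ => 1 / (((2 * m + 1 : ℕ) : ℝ) + 1) ^ 3) (1 / 8 * zeta3) := by
    refine (hz.mul_left (1 / 8)).congr_fun ?_
    intro m
    push_cast
    field_simp
    ring
  have heven_s : Summable (fun m : ℕ => 1 / (((2 * m : ℕ) : ℝ) + 1) ^ 3) :=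
    hs.comp_injective (i := fun m : ℕ => 2 * m) fun a b h => by simpa using h
  obtain ⟨E, heven⟩ := heven_s
  have hE := (heven.even_add_odd (f := fun m : ℕ => 1 / ((m : ℝ) + 1) ^ 3) hodd).unique hz
  have h := HasSum.even_add_odd (f := fun m : ℕ => (-1 : ℝ) ^ m / ((m : ℝ) + 1) ^ 3)
    (by simpa [pow_mul] using heven) (by simpa [pow_mul, pow_succ, neg_div] using hodd.neg)
  convert h using 1
  linarith

lemma summable_alternating_odd_pow {k : ℕ} (hk : 1 < k) :
    Summable (fun n : ℕ => (-1 : ℝ) ^ n / (2 * (n : ℝ) + 1) ^ k) := by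
  have h := (summable_nat_add_iff 1).2 (Real.summable_one_div_nat_pow.2 hk)
  refine Summable.of_norm_bounded h fun n => ?_
  rw [norm_div, norm_pow, norm_neg, norm_one, one_pow, norm_of_nonneg (by positivity)]
  push_cast
  gcongr
  linarith [(Nat.cast_nonneg n : (0 : ℝ) ≤ n)]

lemma cos_ne_zero_of_mem_uIcc {t : ℝ} (ht : t ∈ Set.uIcc 0 (π / 4)) : cos t ≠ 0 := by
  rw [Set.uIcc_of_le (by positivity)] at ht
  exact (cos_pos_of_mem_Ioo ⟨by linarith [ht.1, pi_pos], by linarith [ht.2, pi_pos]⟩).ne'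

lemma continuousOn_tan_uIcc : ContinuousOn tan (Set.uIcc 0 (π / 4)) := fun _ ht =>
  (hasDerivAt_tan (cos_ne_zero_of_mem_uIcc ht)).continuousAt.continuousWithinAt

lemma integral_pow_three_mul_sin_pair (m : ℕ) :
    ∫ t in (0 : ℝ)..(π / 4), t ^ 3 * (2 * sin ((4 * m + 2) * t) - 2 * sin ((4 * m + 4) * t))
      = -(π ^ 3 / 128) * ((-1) ^ m / ((m : ℝ) + 1))
        + 3 * π / 64 * ((-1) ^ m / ((m : ℝ) + 1) ^ 3)
        + 3 * π ^ 2 / 32 * ((-1) ^ m / (2 * (m : ℝ) + 1) ^ 2)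
        - 3 / 4 * ((-1) ^ m / (2 * (m : ℝ) + 1) ^ 4) := by
  have e : ∀ t : ℝ, t ^ 3 * (2 * sin ((4 * m + 2) * t) - 2 * sin ((4 * m + 4) * t))
      = 2 * (t ^ 3 * sin ((4 * m + 2) * t)) - 2 * (t ^ 3 * sin ((4 * m + 4) * t)) :=
    fun t => by ring
  simp only [e]
  rw [intervalIntegral.integral_sub (Continuous.intervalIntegrable (by fun_prop) _ _)
      (Continuous.intervalIntegrable (by fun_prop) _ _),
    intervalIntegral.integral_const_mul, intervalIntegral.integral_const_mul,
    integral_pow_three_mul_sin (by positivity), integral_pow_three_mul_sin (by positivity),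
    show (4 * (m : ℝ) + 2) * (π / 4) = m * π + π / 2 by ring,
    show (4 * (m : ℝ) + 4) * (π / 4) = (m + 1 : ℕ) * π by push_cast; ring,
    sin_add_pi_div_two, cos_add_pi_div_two, cos_nat_mul_pi, cos_nat_mul_pi, sin_nat_mul_pi,
    sin_nat_mul_pi, show 4 * (m : ℝ) + 2 = 2 * (2 * m + 1) by ring,
    show 4 * (m : ℝ) + 4 = 4 * (m + 1) by ring, pow_succ]
  field_simp
  ring

lemma integral_pow_three_mul_tan :
    ∫ t in (0 : ℝ)..(π / 4), t ^ 3 * tan t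
      = -(π ^ 3 / 128) * log 2 + 9 * π / 256 * zeta3 + 3 * π ^ 2 / 32 * catalanConst
        - 3 / 4 * beta4 := by
  have hrem : Tendsto (fun M : ℕ => ∫ t in (0 : ℝ)..(π / 4),
      t ^ 3 / cos t * sin ((4 * M + 1) * t)) atTop (𝓝 0) := by
    have hN : Tendsto (fun M : ℕ => 4 * (M : ℝ) + 1) atTop atTop :=
      tendsto_atTop_add_const_right _ _
        (tendsto_natCast_atTop_atTop.const_mul_atTop (by norm_num))
    refine (tendsto_integral_mul_sin_of_hasDerivAt (u := fun t => t ^ 3 / cos t)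
      (u' := fun t => (3 * t ^ 2 * cos t - t ^ 3 * (-sin t)) / cos t ^ 2) ?_ ?_).comp hN
    · intro t ht
      exact ((hasDerivAt_pow 3 t).div (hasDerivAt_cos t) (cos_ne_zero_of_mem_uIcc ht)).congr_deriv
        (by simp)
    · exact ContinuousOn.div (by fun_prop) (by fun_prop)
        fun t ht => pow_ne_zero 2 (cos_ne_zero_of_mem_uIcc ht)
  have hsum : ∀ M : ℕ, ∑ m ∈ Finset.range M, (-(π ^ 3 / 128) * ((-1) ^ m / ((m : ℝ) + 1))
        + 3 * π / 64 * ((-1) ^ m / ((m : ℝ) + 1) ^ 3)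
        + 3 * π ^ 2 / 32 * ((-1) ^ m / (2 * (m : ℝ) + 1) ^ 2)
        - 3 / 4 * ((-1) ^ m / (2 * (m : ℝ) + 1) ^ 4))
      = (∫ t in (0 : ℝ)..(π / 4), t ^ 3 * tan t)
        - ∫ t in (0 : ℝ)..(π / 4), t ^ 3 / cos t * sin ((4 * M + 1) * t) := by
    intro M
    simp only [← integral_pow_three_mul_sin_pair]
    rw [← intervalIntegral.integral_finsetSum
      fun m _ => Continuous.intervalIntegrable (by fun_prop) _ _,
      ← intervalIntegral.integral_sub]
    · refine integral_congr fun t ht => ?_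
      simp only [← Finset.mul_sum]
      rw [sum_sin_eq_tan_sub (cos_ne_zero_of_mem_uIcc ht)]
      ring
    · exact (ContinuousOn.mul (by fun_prop) continuousOn_tan_uIcc).intervalIntegrable
    · exact (ContinuousOn.mul (ContinuousOn.div (by fun_prop) (by fun_prop)
        fun t ht => cos_ne_zero_of_mem_uIcc ht) (by fun_prop)).intervalIntegrable
  have hlim := (tendsto_const_nhds (x := ∫ t in (0 : ℝ)..(π / 4), t ^ 3 * tan t)).sub hrem
  have hG : HasSum (fun n : ℕ => (-1 : ℝ) ^ n / (2 * (n : ℝ) + 1) ^ 2) catalanConst :=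
    (summable_alternating_odd_pow (by norm_num)).hasSum
  have hB : HasSum (fun n : ℕ => (-1 : ℝ) ^ n / (2 * (n : ℝ) + 1) ^ 4) beta4 :=
    (summable_alternating_odd_pow (by norm_num)).hasSum
  have hser := (((tendsto_alternating_harmonic.const_mul (-(π ^ 3 / 128))).add
    (hasSum_alternating_cubes.tendsto_sum_nat.const_mul (3 * π / 64))).add
    (hG.tendsto_sum_nat.const_mul (3 * π ^ 2 / 32))).sub
    (hB.tendsto_sum_nat.const_mul (3 / 4))
  simp only [Finset.mul_sum, ← Finset.sum_add_distrib, ← Finset.sum_sub_distrib] at hser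
  have h := tendsto_nhds_unique (hser.congr hsum) hlim
  linarith

lemma integral_arctan_pow_four :
    ∫ x in (0 : ℝ)..1, arctan x ^ 4
      = (π / 4) ^ 4 - 4 * ∫ t in (0 : ℝ)..(π / 4), t ^ 3 * tan t := by
  have hinv : ContinuousOn (fun t => 1 / cos t ^ 2) (Set.uIcc 0 (π / 4)) :=
    ContinuousOn.div (by fun_prop) (by fun_prop)
      fun t ht => pow_ne_zero 2 (cos_ne_zero_of_mem_uIcc ht)
  have htan : ∀ t ∈ Set.uIcc 0 (π / 4), HasDerivAt tan (1 / cos t ^ 2) t :=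
    fun t ht => hasDerivAt_tan (cos_ne_zero_of_mem_uIcc ht)
  have hsub := integral_comp_mul_deriv (g := fun x => arctan x ^ 4) htan hinv
    (continuous_arctan.pow 4)
  rw [tan_zero, tan_pi_div_four] at hsub
  have hpow : ∀ t ∈ Set.uIcc 0 (π / 4), HasDerivAt (fun t : ℝ => t ^ 4) (4 * t ^ 3) t :=
    fun t _ => by simpa using hasDerivAt_pow 4 t
  have hcongr : ∫ t in (0 : ℝ)..(π / 4), ((fun x => arctan x ^ 4) ∘ tan) t * (1 / cos t ^ 2)
      = ∫ t in (0 : ℝ)..(π / 4), t ^ 4 * (1 / cos t ^ 2) := by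
    refine integral_congr fun t ht => ?_
    rw [Set.uIcc_of_le (by positivity)] at ht
    simp only [Function.comp_apply]
    rw [arctan_tan (by linarith [ht.1, pi_pos]) (by linarith [ht.2, pi_pos])]
  rw [← hsub, hcongr, integral_mul_deriv_eq_deriv_mul hpow htan
    (Continuous.intervalIntegrable (by fun_prop) _ _) hinv.intervalIntegrable, tan_pi_div_four,
    ← intervalIntegral.integral_const_mul]
  simp [mul_assoc]

theorem arctan_fourth_integral :
    ∫ x in (0:ℝ)..1, Real.arctan x ^ 4
      = π ^ 4 / 256 + (π ^ 3 / 32) * Real.log 2 - (3/8) * π ^ 2 * catalanConst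
        - (9/64) * π * zeta3 + 3 * beta4 := by
  rw [integral_arctan_pow_four, integral_pow_three_mul_tan]
  ring
end

section
/- The integral from 0 to 1 of arctan(x)²/x dx equals (1/2)·π·G − (7/8)·ζ(3). -/
open Real

open MeasureTheory Filter Topology

lemma mul_sinc_eq_sin (u : ℝ) : u * sinc u = sin u := by
  by_cases h : u = 0
  · simp [h]
  · rw [sinc_of_ne_zero h]
    field_simp

lemma sinc_pos_of_mem_Ico {u : ℝ} (hu : u ∈ Set.Ico 0 π) : 0 < sinc u := by
  rcases hu.1.eq_or_lt with h | h
  · simp [← h]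
  · rw [sinc_of_ne_zero h.ne']
    exact div_pos (sin_pos_of_pos_of_lt_pi h hu.2) h

lemma continuousOn_div_sinc : ContinuousOn (fun u : ℝ => u / sinc u) (Set.Icc 0 (π / 2)) :=
  continuousOn_id.div continuous_sinc.continuousOn fun _ hu =>
    (sinc_pos_of_mem_Ico ⟨hu.1, by linarith [hu.2, pi_pos]⟩).ne'

lemma sin_mul_sum_sin_odd (u : ℝ) (n : ℕ) :
    sin u * ∑ k ∈ Finset.range n, 2 * sin ((2 * k + 1) * u) = 1 - cos (2 * n * u) := by
  induction n with
  | zero => simp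
  | succ n ih =>
    rw [Finset.sum_range_succ, mul_add, ih]
    have h1 : (2 * ((n + 1 : ℕ) : ℝ)) * u = (2 * n + 1) * u + u := by push_cast; ring
    have h2 : 2 * (n : ℝ) * u = (2 * n + 1) * u - u := by ring
    rw [h1, h2, cos_add, cos_sub]
    ring

lemma integral_sq_mul_sin_odd (k : ℕ) :
    ∫ u in (0 : ℝ)..(π / 2), u ^ 2 * (2 * sin ((2 * k + 1) * u))
      = 2 * π * ((-1) ^ k / (2 * (k : ℝ) + 1) ^ 2) - 4 * (1 / (2 * (k : ℝ) + 1) ^ 3) := by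
  set m : ℝ := 2 * k + 1 with hm
  have hm0 : m ≠ 0 := by positivity
  have hderiv (u : ℝ) : HasDerivAt
      (fun u => 2 * (-(u ^ 2 * cos (m * u)) / m + 2 * (u * sin (m * u)) / m ^ 2
        + 2 * cos (m * u) / m ^ 3)) (u ^ 2 * (2 * sin (m * u))) u := by
    have hmu : HasDerivAt (fun u : ℝ => m * u) m u := by
      simpa using (hasDerivAt_id u).const_mul m
    have hc := hmu.cos
    have hs := hmu.sin
    have hsq : HasDerivAt (fun u : ℝ => u ^ 2) (2 * u) u := by simpa using hasDerivAt_pow 2 u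
    refine HasDerivAt.congr_deriv (((((hsq.mul hc).neg.div_const m).add
      ((((hasDerivAt_id u).mul hs).const_mul 2).div_const (m ^ 2))).add
      ((hc.const_mul 2).div_const (m ^ 3))).const_mul 2) ?_
    simp only [id]
    field_simp
    ring
  rw [intervalIntegral.integral_eq_sub_of_hasDerivAt (fun u _ => hderiv u)
    (by apply Continuous.intervalIntegrable; fun_prop)]
  have harg : m * (π / 2) = k * π + π / 2 := by rw [hm]; ring
  have hcos : cos (m * (π / 2)) = 0 := by
    rw [harg, cos_add_pi_div_two, sin_nat_mul_pi, neg_zero]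
  have hsin : sin (m * (π / 2)) = (-1) ^ k := by
    rw [harg, sin_add_pi_div_two, cos_nat_mul_pi]
  rw [hcos, hsin]
  simp
  field_simp
  ring

lemma tendsto_setIntegral_mul_cos_nat (f : ℝ → ℝ) {a b : ℝ} (hab : a ≤ b)
    (hf : IntervalIntegrable f volume a b) :
    Tendsto (fun n : ℕ => ∫ u in a..b, f u * cos (2 * n * u)) atTop (𝓝 0) := by
  have hRL := Real.tendsto_integral_exp_smul_cocompact
    (fun u => (Set.Ioc a b).indicator (fun u => (f u : ℂ)) u)
  have hw : Tendsto (fun n : ℕ => (n : ℝ) / π) atTop (cocompact ℝ) :=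
    (tendsto_natCast_atTop_atTop.atTop_div_const pi_pos).mono_right atTop_le_cocompact
  have hre := (Complex.continuous_re.tendsto 0).comp (hRL.comp hw)
  simp only [Complex.zero_re] at hre
  refine hre.congr fun n => ?_
  have hind : (fun v : ℝ => (fourierChar (-(v * ((n : ℝ) / π)))) •
      (Set.Ioc a b).indicator (fun u => (f u : ℂ)) v)
      = (Set.Ioc a b).indicator
        (fun v => Complex.exp (((-(2 * n * v) : ℝ) : ℂ) * Complex.I) * (f v : ℂ)) := by
    ext v
    by_cases hv : v ∈ Set.Ioc a b
    · simp only [Set.indicator_of_mem hv, Circle.smul_def, fourierChar_apply, smul_eq_mul]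
      congr 4
      field_simp
    · simp [Set.indicator_of_notMem hv]
  have hint : IntegrableOn
      (fun v => Complex.exp (((-(2 * n * v) : ℝ) : ℂ) * Complex.I) * (f v : ℂ))
      (Set.Ioc a b) := by
    rw [intervalIntegrable_iff_integrableOn_Ioc_of_le hab] at hf
    refine (Integrable.ofReal hf).bdd_mul (c := 1) (by fun_prop) ?_
    exact .of_forall fun v => (Complex.norm_exp_ofReal_mul_I _).le
  simp only [Function.comp_apply]
  rw [hind, integral_indicator measurableSet_Ioc, intervalIntegral.integral_of_le hab]
  have := integral_re hint
  simp only [RCLike.re_eq_complex_re] at this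
  rw [← this]
  congr 1 with v
  rw [Complex.re_mul_ofReal, Complex.exp_ofReal_mul_I_re, cos_neg, mul_comm]

lemma hasSum_one_div_odd_cube :
    HasSum (fun n : ℕ => 1 / (2 * (n : ℝ) + 1) ^ 3) (7 / 8 * zeta3) := by
  have hs : Summable (fun n : ℕ => 1 / (n : ℝ) ^ 3) :=
    Real.summable_one_div_nat_pow.2 (by norm_num)
  have hz : zeta3 = ∑' n : ℕ, 1 / (n : ℝ) ^ 3 := by
    rw [hs.tsum_eq_zero_add, zeta3]
    simp
  have hodd : Summable (fun n : ℕ => 1 / (2 * (n : ℝ) + 1) ^ 3) := by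
    simpa [Function.comp_def] using
      hs.comp_injective (i := fun n : ℕ => 2 * n + 1) (fun a b h => by simpa using h)
  have heven : HasSum (fun n : ℕ => 1 / (((2 * n : ℕ) : ℝ)) ^ 3) (1 / 8 * zeta3) := by
    rw [hz]
    have h (n : ℕ) : 1 / (((2 * n : ℕ) : ℝ)) ^ 3 = 1 / 8 * (1 / (n : ℝ) ^ 3) := by
      push_cast
      rw [mul_pow, one_div_mul_one_div]
      norm_num
    simpa only [h] using hs.hasSum.mul_left (1 / 8)
  have hodd' : Summable (fun n : ℕ => 1 / (((2 * n + 1 : ℕ) : ℝ)) ^ 3) := by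
    simpa using hodd
  have hadd := tsum_even_add_odd (f := fun n : ℕ => 1 / (n : ℝ) ^ 3) heven.summable hodd'
  rw [heven.tsum_eq, ← hz] at hadd
  have hval : ∑' n : ℕ, 1 / (2 * (n : ℝ) + 1) ^ 3 = 7 / 8 * zeta3 := by
    push_cast at hadd
    linarith
  exact hval ▸ hodd.hasSum

lemma hasSum_catalanConst :
    HasSum (fun n : ℕ => (-1 : ℝ) ^ n / (2 * (n : ℝ) + 1) ^ 2) catalanConst := by
  have hs : Summable (fun n : ℕ => 1 / (n : ℝ) ^ 2) :=
    Real.summable_one_div_nat_pow.2 (by norm_num)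
  have hodd : Summable (fun n : ℕ => 1 / (2 * (n : ℝ) + 1) ^ 2) := by
    simpa [Function.comp_def] using
      hs.comp_injective (i := fun n : ℕ => 2 * n + 1) (fun a b h => by simpa using h)
  refine (Summable.of_norm_bounded hodd fun n => ?_).hasSum
  simp

/-- `∫₀^{π/2} u² / sin u du = 2πG - (7/2) ζ(3)`. -/
lemma integral_div_sinc :
    ∫ u in (0 : ℝ)..(π / 2), u / sinc u = 2 * π * catalanConst - 7 / 2 * zeta3 := by
  have hpi : (0 : ℝ) ≤ π / 2 := by positivity
  have hint : IntervalIntegrable (fun u : ℝ => u / sinc u) volume 0 (π / 2) :=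
    ContinuousOn.intervalIntegrable_of_Icc hpi continuousOn_div_sinc
  have hcosint (n : ℕ) :
      IntervalIntegrable (fun u : ℝ => u / sinc u * cos (2 * n * u)) volume 0 (π / 2) :=
    hint.mul_continuousOn (by fun_prop)
  have hpartial (n : ℕ) :
      ∑ k ∈ Finset.range n, (2 * π * ((-1) ^ k / (2 * (k : ℝ) + 1) ^ 2)
        - 4 * (1 / (2 * (k : ℝ) + 1) ^ 3))
      = (∫ u in (0 : ℝ)..(π / 2), u / sinc u)
        - ∫ u in (0 : ℝ)..(π / 2), u / sinc u * cos (2 * n * u) := by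
    rw [← intervalIntegral.integral_sub hint (hcosint n)]
    simp_rw [← integral_sq_mul_sin_odd]
    rw [← intervalIntegral.integral_finsetSum
      (fun k _ => by apply Continuous.intervalIntegrable; fun_prop)]
    refine intervalIntegral.integral_congr fun u hu => ?_
    rw [Set.uIcc_of_le hpi] at hu
    have hne : sinc u ≠ 0 := (sinc_pos_of_mem_Ico ⟨hu.1, by linarith [hu.2, pi_pos]⟩).ne'
    have hsq : u / sinc u * sin u = u ^ 2 := by
      rw [← mul_sinc_eq_sin]
      field_simp
    calc ∑ k ∈ Finset.range n, u ^ 2 * (2 * sin ((2 * k + 1) * u))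
        = u / sinc u * (sin u * ∑ k ∈ Finset.range n, 2 * sin ((2 * k + 1) * u)) := by
          rw [← Finset.mul_sum, ← mul_assoc, hsq]
      _ = u / sinc u - u / sinc u * cos (2 * n * u) := by
          rw [sin_mul_sum_sin_odd]
          ring
  have hlim := (tendsto_setIntegral_mul_cos_nat _ hpi hint).const_sub
    (∫ u in (0 : ℝ)..(π / 2), u / sinc u)
  rw [sub_zero] at hlim
  have hsum := ((hasSum_catalanConst.mul_left (2 * π)).sub
    (hasSum_one_div_odd_cube.mul_left 4)).tendsto_sum_nat
  rw [tendsto_nhds_unique (hlim.congr fun n => (hpartial n).symm) hsum]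
  ring

lemma sin_two_mul_arctan (x : ℝ) : sin (2 * arctan x) = 2 * x / (1 + x ^ 2) := by
  have h : √(1 + x ^ 2) ^ 2 = 1 + x ^ 2 := sq_sqrt (by positivity)
  rw [sin_two_mul, sin_arctan, cos_arctan]
  field_simp
  rw [h]

lemma integral_arctan_sq_div :
    ∫ x in (0 : ℝ)..1, arctan x ^ 2 / x = 1 / 4 * ∫ u in (0 : ℝ)..(π / 2), u / sinc u := by
  have hderiv (x : ℝ) : HasDerivAt (fun x => 2 * arctan x) (2 * (1 / (1 + x ^ 2))) x :=
    (hasDerivAt_arctan x).const_mul 2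
  have himage : (fun x => 2 * arctan x) '' Set.uIcc (0 : ℝ) 1 ⊆ Set.Icc 0 (π / 2) := by
    rintro _ ⟨x, hx, rfl⟩
    rw [Set.uIcc_of_le zero_le_one] at hx
    have h0 : 0 ≤ arctan x := by simpa using arctan_strictMono.monotone hx.1
    have h1 : arctan x ≤ π / 4 := by simpa using arctan_strictMono.monotone hx.2
    constructor <;> dsimp only <;> linarith
  have hsubst := intervalIntegral.integral_comp_mul_deriv'' (a := 0) (b := 1)
    (f := fun x => 2 * arctan x) (f' := fun x => 2 * (1 / (1 + x ^ 2)))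
    (g := fun u => u / sinc u) (by fun_prop)
    (fun x _ => (hderiv x).hasDerivWithinAt)
    (Continuous.continuousOn
      (continuous_const.mul (continuous_const.div (by fun_prop) fun x => by positivity)))
    (continuousOn_div_sinc.mono himage)
  have hend : 2 * arctan 1 = π / 2 := by rw [arctan_one]; ring
  simp only [arctan_zero, mul_zero, hend] at hsubst
  rw [← hsubst, ← intervalIntegral.integral_const_mul]
  congr 1 with x
  by_cases hx : x = 0
  · simp [hx]
  · have hx' : 2 * arctan x ≠ 0 := by simpa using hx
    simp only [Function.comp_apply]
    rw [sinc_of_ne_zero hx', sin_two_mul_arctan]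
    have : 1 + x ^ 2 ≠ 0 := by positivity
    field_simp
    ring

theorem arctan_sq_div_x_integral :
    ∫ x in (0:ℝ)..1, Real.arctan x ^ 2 / x
      = (1/2) * π * catalanConst - (7/8) * zeta3 := by
  rw [integral_arctan_sq_div, integral_div_sinc]
  ring
end
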